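/- Every maximal chain of a Gorenstein* finite poset P has the same length; equivalently, P_{⊥,⊤} admits a rank function, i.e., a function r : P_{⊥,⊤} → ℤ such that r(q) = r(p) + 1 whenever q is an immediate successor of p. -/

import Mathlib

open CategoryTheory Limits

variable (X : Type) [PartialOrder X]

/-- The set of `k`-element chains (strictly increasing tuples) in `X`. -/
def SimplexChain (k : ℕ) : Type := {f : Fin k → X // StrictMono f}

/-- The group of simplicial chains: free abelian group on `k`-element chains. -/
abbrev ChainGrp (k : ℕ) : Type := FreeAbelianGroup (SimplexChain X k)

/-- The boundary map of the augmented simplicial chain complex of the order complex. -/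
noncomputable def bdry (k : ℕ) : ChainGrp X (k + 1) →+ ChainGrp X k :=
  FreeAbelianGroup.lift fun f : SimplexChain X (k + 1) =>
    ∑ i : Fin (k + 1), ((-1 : ℤ) ^ (i : ℕ)) •
      FreeAbelianGroup.of
        (⟨f.1 ∘ (Fin.succAboveOrderEmb i), f.2.comp (Fin.succAboveOrderEmb i).strictMono⟩ :
          SimplexChain X k)

/-- Cycles (in degree `k`, corresponding to simplicial dimension `k - 1`). -/
noncomputable def cycles : ∀ k : ℕ, AddSubgroup (ChainGrp X k)
  | 0 => ⊤
  | (k + 1) => (bdry X k).ker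

/-- Boundaries. -/
noncomputable def boundaries (k : ℕ) : AddSubgroup (ChainGrp X k) := (bdry X k).range

/-- Reduced homology `H̃_{k-1}` of (the order complex of) the poset `X`;
the index is shifted so that `reducedHomology X 0 = H̃_{-1}(X)`. -/
noncomputable abbrev reducedHomology (k : ℕ) : Type :=
  cycles X k ⧸ (boundaries X k).addSubgroupOf (cycles X k)

/-- `X` has the reduced integral homology of a sphere (with `S^{-1} = ∅` allowed). -/
def HasSphereHomology : Prop :=
  ∃ n : ℕ, Nonempty (reducedHomology X n ≃+ ℤ) ∧
    ∀ i : ℕ, i ≠ n → Subsingleton (reducedHomology X i)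

/-- A finite poset `Q` is Gorenstein* (over `ℤ`) if every open interval `(p, q)` for
`p < q` in `Q` with a new bottom and top element adjoined has the integral homology
of a sphere. -/
def IsGorensteinStar (Q : Type) [PartialOrder Q] [Finite Q] : Prop :=
  ∀ p q : WithBot (WithTop Q), p < q → HasSphereHomology ↥(Set.Ioo p q)

namespace SimplexChain

variable {X}

/-- The face of a chain obtained by deleting its `i`-th element. -/
def face {k : ℕ} (i : Fin (k + 1)) (f : SimplexChain X (k + 1)) : SimplexChain X k :=
  ⟨f.1 ∘ Fin.succAboveOrderEmb i, f.2.comp (Fin.succAboveOrderEmb i).strictMono⟩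

/-- A chain is maximal if no element is strictly comparable to all of its members. -/
def IsMaximal {k : ℕ} (f : SimplexChain X k) : Prop :=
  ∀ y, ∃ j, ¬(y < f.1 j ∨ f.1 j < y)

/-- The chain consisting of a single element. -/
def single (x : X) : SimplexChain X 1 := ⟨fun _ => x, Subsingleton.strictMono _⟩

@[ext]
theorem ext {k : ℕ} {f g : SimplexChain X k} (h : ∀ j, f.1 j = g.1 j) : f = g :=
  Subtype.ext (funext h)

instance instFinite [Finite X] (k : ℕ) : Finite (SimplexChain X k) :=
  inferInstanceAs (Finite {f : Fin k → X // StrictMono f})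

instance instUniqueZero : Unique (SimplexChain X 0) where
  default := ⟨Fin.elim0, fun i => i.elim0⟩
  uniq _ := ext fun j => j.elim0

theorem face_ne_of_isMaximal {k : ℕ} {f : SimplexChain X k} (hf : f.IsMaximal)
    (i : Fin (k + 1)) (g : SimplexChain X (k + 1)) : face i g ≠ f := by
  rintro rfl
  obtain ⟨j, hj⟩ := hf (g.1 i)
  refine hj ?_
  rcases lt_or_gt_of_ne (Fin.succAbove_ne i j) with h | h
  · exact Or.inr (g.2 h)
  · exact Or.inl (g.2 h)

theorem face_face {k : ℕ} (i : Fin (k + 2)) (j : Fin (k + 1)) (f : SimplexChain X (k + 2)) :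
    face (j.predAbove i) (face (i.succAbove j) f) = face j (face i f) := by
  ext l
  change f.1 ((i.succAbove j).succAbove ((j.predAbove i).succAbove l)) =
    f.1 (i.succAbove (j.succAbove l))
  rw [Fin.succAbove_succAbove_succAbove_predAbove]

end SimplexChain

open SimplexChain

variable {X}

theorem bdry_of {k : ℕ} (f : SimplexChain X (k + 1)) :
    bdry X k (FreeAbelianGroup.of f) =
      ∑ i : Fin (k + 1), ((-1 : ℤ) ^ (i : ℕ)) • FreeAbelianGroup.of (face i f) :=
  FreeAbelianGroup.lift_apply_of _ _

theorem bdry_bdry {k : ℕ} (x : ChainGrp X (k + 2)) : bdry X k (bdry X (k + 1) x) = 0 := by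
  suffices h : (bdry X k).comp (bdry X (k + 1)) = 0 from DFunLike.congr_fun h x
  refine FreeAbelianGroup.lift_ext _ _ fun f => ?_
  simp only [AddMonoidHom.comp_apply, bdry_of, map_sum, map_zsmul, AddMonoidHom.zero_apply,
    Finset.smul_sum, smul_smul, ← pow_add]
  rw [← Finset.sum_product' Finset.univ Finset.univ (fun (i : Fin (k + 2)) (j : Fin (k + 1)) =>
    ((-1 : ℤ) ^ ((i : ℕ) + j)) • FreeAbelianGroup.of (face j (face i f)))]
  refine Finset.sum_involution (fun p _ => (p.1.succAbove p.2, p.2.predAbove p.1)) ?_ ?_ ?_ ?_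
  · rintro ⟨i, j⟩ -
    simp only [face_face, Fin.neg_one_pow_succAbove_add_predAbove, neg_smul, add_neg_cancel]
  · rintro ⟨i, j⟩ - - h
    exact Fin.succAbove_ne i j (congrArg Prod.fst h)
  · simp
  · rintro ⟨i, j⟩ -
    simp [Fin.succAbove_succAbove_predAbove, Fin.predAbove_predAbove_succAbove]

theorem FreeAbelianGroup.coeff_of {α : Type*} [DecidableEq α] (a b : α) :
    FreeAbelianGroup.coeff a (FreeAbelianGroup.of b) = if b = a then 1 else 0 := by
  simp [FreeAbelianGroup.coeff, Finsupp.single_apply]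

/-- Boundaries have vanishing coefficients at maximal chains. -/
theorem coeff_eq_zero_of_mem_boundaries {k : ℕ} {f : SimplexChain X k} (hf : f.IsMaximal)
    {x : ChainGrp X k} (hx : x ∈ boundaries X k) : FreeAbelianGroup.coeff f x = 0 := by
  classical
  obtain ⟨v, rfl⟩ := hx
  suffices h : (FreeAbelianGroup.coeff f).comp (bdry X k) = 0 from DFunLike.congr_fun h v
  refine FreeAbelianGroup.lift_ext _ _ fun g => ?_
  simp [bdry_of, FreeAbelianGroup.coeff_of, face_ne_of_isMaximal hf]

theorem boundaries_le_cycles (k : ℕ) : boundaries X k ≤ cycles X k := by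
  rintro _ ⟨v, rfl⟩
  cases k with
  | zero => exact AddSubgroup.mem_top _
  | succ k => exact bdry_bdry v

theorem reducedHomology_mk_eq_zero_iff {k : ℕ} (x : cycles X k) :
    (QuotientAddGroup.mk x : reducedHomology X k) = 0 ↔ (x : ChainGrp X k) ∈ boundaries X k := by
  rw [QuotientAddGroup.eq_zero_iff, AddSubgroup.mem_addSubgroupOf]

namespace HasSphereHomology

/-- The homology of a sphere is concentrated in a single degree. -/
theorem degree_unique (h : HasSphereHomology X) {k l : ℕ} {x : ChainGrp X k} {y : ChainGrp X l}
    (hx : x ∈ cycles X k) (hx' : x ∉ boundaries X k) (hy : y ∈ cycles X l)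
    (hy' : y ∉ boundaries X l) : k = l := by
  obtain ⟨n, -, hn⟩ := h
  have key : ∀ {m : ℕ} {z : ChainGrp X m}, z ∈ cycles X m → z ∉ boundaries X m → m = n := by
    intro m z hz hz'
    by_contra hne
    have := hn m hne
    exact hz' ((reducedHomology_mk_eq_zero_iff ⟨z, hz⟩).1 (Subsingleton.elim _ _))
  rw [key hx hx', key hy hy']

/-- The homology of a sphere has rank one in its only nontrivial degree. -/
theorem exists_smul_add_smul_mem_boundaries (h : HasSphereHomology X) {k : ℕ} {x y : ChainGrp X k}
    (hx : x ∈ cycles X k) (hy : y ∈ cycles X k) :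
    ∃ a b : ℤ, (a ≠ 0 ∨ b ≠ 0) ∧ a • x + b • y ∈ boundaries X k := by
  obtain ⟨n, ⟨e⟩, hn⟩ := h
  by_cases hk : k = n
  · subst hk
    set u := e (QuotientAddGroup.mk ⟨x, hx⟩) with hu
    set v := e (QuotientAddGroup.mk ⟨y, hy⟩) with hv
    by_cases h0 : u = 0
    · refine ⟨1, 0, by simp, ?_⟩
      rw [hu, map_eq_zero_iff e e.injective, reducedHomology_mk_eq_zero_iff] at h0
      simpa using h0
    · refine ⟨v, -u, Or.inr (neg_ne_zero.2 h0), ?_⟩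
      refine (reducedHomology_mk_eq_zero_iff (v • ⟨x, hx⟩ + (-u) • ⟨y, hy⟩)).1 ?_
      apply e.injective
      rw [QuotientAddGroup.mk_add, QuotientAddGroup.mk_zsmul, QuotientAddGroup.mk_zsmul,
        map_add, map_zsmul, map_zsmul, ← hu, ← hv, map_zero]
      simp only [smul_eq_mul]
      ring
  · have := hn k hk
    refine ⟨1, 0, by simp, ?_⟩
    have := (reducedHomology_mk_eq_zero_iff ⟨x, hx⟩).1 (Subsingleton.elim _ _)
    simpa using this

/-- The homology of a sphere is torsion-free. -/
theorem mem_boundaries_of_two_nsmul (h : HasSphereHomology X) {k : ℕ} {x : ChainGrp X k}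
    (hx : x ∈ cycles X k) (hx2 : 2 • x ∈ boundaries X k) : x ∈ boundaries X k := by
  obtain ⟨n, ⟨e⟩, hn⟩ := h
  rw [← reducedHomology_mk_eq_zero_iff ⟨x, hx⟩]
  by_cases hk : k = n
  · subst hk
    have h2 := (reducedHomology_mk_eq_zero_iff (2 • ⟨x, hx⟩)).2 hx2
    have h3 := congrArg e h2
    rw [QuotientAddGroup.mk_nsmul, map_nsmul, map_zero] at h3
    apply e.injective
    rw [map_zero]
    simpa using h3
  · have := hn k hk
    exact Subsingleton.elim _ _

theorem exists_mem_cycles_notMem_boundaries (h : HasSphereHomology X) :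
    ∃ (k : ℕ) (x : ChainGrp X k), x ∈ cycles X k ∧ x ∉ boundaries X k := by
  obtain ⟨n, ⟨e⟩, -⟩ := h
  obtain ⟨⟨x, hx⟩, h1⟩ := QuotientAddGroup.mk_surjective (e.symm 1)
  refine ⟨n, x, hx, fun hb => ?_⟩
  rw [(reducedHomology_mk_eq_zero_iff ⟨x, hx⟩).2 hb] at h1
  have := congrArg e h1
  simp at this

end HasSphereHomology

/-- If every codimension-one face lies in an even number of maximal chains of its size plus one,
the sum of all these maximal chains is, modulo two, a nontrivial homology class. -/
theorem exists_cycle_of_even [Finite X] (h : HasSphereHomology X) {k : ℕ}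
    (hev : ∀ (i : Fin (k + 2)) (t : SimplexChain X (k + 1)),
      Even (Nat.card {f : SimplexChain X (k + 2) // f.IsMaximal ∧ face i f = t}))
    {s : SimplexChain X (k + 2)} (hs : s.IsMaximal) :
    ∃ x ∈ cycles X (k + 2), x ∉ boundaries X (k + 2) := by
  classical
  have := Fintype.ofFinite (SimplexChain X (k + 2))
  have := Fintype.ofFinite (SimplexChain X (k + 1))
  set M : Finset (SimplexChain X (k + 2)) := {f | f.IsMaximal} with hM
  set z : ChainGrp X (k + 2) := ∑ f ∈ M, FreeAbelianGroup.of f with hz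
  have half : ∀ i : Fin (k + 2), ∃ w : ChainGrp X (k + 1),
      ∑ f ∈ M, FreeAbelianGroup.of (face i f) = 2 • w := by
    intro i
    choose c hc using hev i
    refine ⟨∑ t, c t • FreeAbelianGroup.of t, ?_⟩
    rw [← Finset.sum_fiberwise M (face i), Finset.smul_sum]
    refine Finset.sum_congr rfl fun t _ => ?_
    rw [Finset.sum_congr rfl (g := fun _ => FreeAbelianGroup.of t)
      (fun f hf => by rw [(Finset.mem_filter.1 hf).2]), Finset.sum_const, smul_smul, two_mul,
      ← hc t, Nat.card_eq_fintype_card, Fintype.card_subtype, hM, Finset.filter_filter]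
  choose w hw using half
  have hbz : bdry X (k + 1) z = 2 • ∑ i : Fin (k + 2), ((-1 : ℤ) ^ (i : ℕ)) • w i := by
    simp only [hz, map_sum, bdry_of]
    rw [Finset.sum_comm, Finset.smul_sum]
    refine Finset.sum_congr rfl fun i _ => ?_
    rw [← Finset.smul_sum, hw, smul_comm]
  set W := ∑ i : Fin (k + 2), ((-1 : ℤ) ^ (i : ℕ)) • w i
  have hWc : W ∈ cycles X (k + 1) := by
    have h0 := bdry_bdry z
    rw [hbz, map_nsmul] at h0
    have : (bdry X k) W = 0 := by
      refine (FreeAbelianGroup.equivFinsupp _).injective ?_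
      have := congrArg (FreeAbelianGroup.equivFinsupp _) h0
      rw [map_nsmul, map_zero] at this
      rw [map_zero]
      simpa using this
    exact this
  obtain ⟨u, hu⟩ := h.mem_boundaries_of_two_nsmul hWc ⟨z, hbz⟩
  refine ⟨z - 2 • u, ?_, fun hb => ?_⟩
  · change bdry X (k + 1) (z - 2 • u) = 0
    rw [map_sub, map_nsmul, hu, hbz, sub_self]
  · have h0 := coeff_eq_zero_of_mem_boundaries hs hb
    rw [map_sub, map_nsmul, hz, map_sum] at h0
    have hsM : s ∈ M := by simp [hM, hs]
    simp only [FreeAbelianGroup.coeff_of, Finset.sum_ite_eq', hsM, if_true] at h0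
    rw [nsmul_eq_mul] at h0
    push_cast at h0
    omega

theorem single_sub_single_mem_cycles (x y : X) :
    FreeAbelianGroup.of (single x) - FreeAbelianGroup.of (single y) ∈ cycles X 1 := by
  change bdry X 0 _ = 0
  simp [bdry_of, Subsingleton.elim (face 0 (single x)) (face 0 (single y))]

theorem exists_cycle_of_single_isMaximal {x y : X} (hx : (single x).IsMaximal) (hxy : x ≠ y) :
    ∃ z ∈ cycles X 1, z ∉ boundaries X 1 := by
  classical
  refine ⟨_, single_sub_single_mem_cycles x y, fun hb => ?_⟩
  have h0 := coeff_eq_zero_of_mem_boundaries hx hb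
  have hne : single y ≠ single x := fun h => hxy (congrFun (congrArg Subtype.val h) 0).symm
  simp [FreeAbelianGroup.coeff_of, hne] at h0

theorem HasSphereHomology.nontrivial_of_nonempty (h : HasSphereHomology X) [Nonempty X] :
    Nontrivial X := by
  by_contra hX
  rw [not_nontrivial_iff_subsingleton] at hX
  obtain ⟨x⟩ := ‹Nonempty X›
  have hbd : bdry X 0 (FreeAbelianGroup.of (single x)) = FreeAbelianGroup.of default := by
    simp [bdry_of, Subsingleton.elim (face 0 (single x)) default]
  have hgen : ∀ {α : Type} [Unique α] (c : FreeAbelianGroup α),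
      ∃ r : ℤ, c = r • FreeAbelianGroup.of default := by
    intro α _ c
    induction c using FreeAbelianGroup.induction_on with
    | zero => exact ⟨0, by simp⟩
    | of a => exact ⟨1, by simp [Subsingleton.elim a default]⟩
    | neg a _ => exact ⟨-1, by simp [Subsingleton.elim a default]⟩
    | add a b ha hb =>
      obtain ⟨r, rfl⟩ := ha
      obtain ⟨s, rfl⟩ := hb
      exact ⟨r + s, (add_smul r s _).symm⟩
  obtain ⟨k, c, hc, hc'⟩ := h.exists_mem_cycles_notMem_boundaries
  apply hc'
  match k, c, hc with
  | 0, c, _ =>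
    obtain ⟨r, rfl⟩ := hgen c
    have hd : FreeAbelianGroup.of default ∈ boundaries X 0 := ⟨_, hbd⟩
    exact AddSubgroup.zsmul_mem _ hd r
  | 1, c, hc =>
    let _ : Unique (SimplexChain X 1) :=
      ⟨⟨single x⟩, fun _ => SimplexChain.ext fun _ => Subsingleton.elim _ _⟩
    obtain ⟨r, rfl⟩ := hgen c
    have h0 : bdry X 0 (r • FreeAbelianGroup.of (single x)) = 0 := hc
    rw [map_zsmul, hbd] at h0
    have h1 := congrArg (FreeAbelianGroup.coeff default) h0
    classical
    rw [map_zsmul, FreeAbelianGroup.coeff_of] at h1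
    have : r = 0 := by simpa using h1
    rw [this, zero_smul]
    exact zero_mem _
  | k + 2, c, _ =>
    have : IsEmpty (SimplexChain X (k + 2)) :=
      ⟨fun f => zero_ne_one (f.2.injective (Subsingleton.elim (f.1 0) (f.1 1)))⟩
    rw [Subsingleton.elim c 0]
    exact zero_mem _

/-- A poset with the homology of a sphere in which all elements are isolated has two elements,
as soon as it is nonempty. -/
theorem HasSphereHomology.card_eq_two (h : HasSphereHomology X) [Nonempty X]
    (hX : ∀ x : X, (single x).IsMaximal) : Nat.card X = 2 := by
  classical
  obtain ⟨x, y, hxy⟩ := h.nontrivial_of_nonempty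
  rw [Nat.card_eq_two_iff]
  refine ⟨x, y, hxy, Set.eq_univ_of_forall fun z => ?_⟩
  by_contra hz
  simp only [Set.mem_insert_iff, Set.mem_singleton_iff, not_or] at hz
  obtain ⟨a, b, hab, hb⟩ := h.exists_smul_add_smul_mem_boundaries
    (single_sub_single_mem_cycles y x) (single_sub_single_mem_cycles z x)
  have hne : ∀ {u v : X}, u ≠ v → single u ≠ single v :=
    fun huv h => huv (congrFun (congrArg Subtype.val h) 0)
  have h1 := coeff_eq_zero_of_mem_boundaries (hX y) hb
  have h2 := coeff_eq_zero_of_mem_boundaries (hX z) hb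
  simp [FreeAbelianGroup.coeff_of, hne hxy, hne hz.2] at h1
  simp [FreeAbelianGroup.coeff_of, hne (Ne.symm hz.1), hne (Ne.symm hz.2)] at h2
  omega

theorem IsMaxChain.exists_isMaximal [Finite X] {M : Set X} (hM : IsMaxChain (· ≤ ·) M) :
    ∃ f : SimplexChain X M.ncard, f.IsMaximal ∧ Set.range f.1 = M := by
  classical
  let F : Flag X := Flag.ofIsMaxChain M hM
  have : Fintype F := Fintype.ofFinite F
  have hcard : Fintype.card F = M.ncard := by
    rw [← Nat.card_eq_fintype_card]
    rfl
  let e := Fintype.orderIsoFinOfCardEq F hcard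
  have hrange : Set.range (fun j => (e j : X)) = M := by
    change Set.range (Subtype.val ∘ e) = M
    rw [Set.range_comp, e.range_eq, Set.image_univ]
    exact Subtype.range_coe
  refine ⟨⟨fun j => e j, fun i j hij => e.strictMono hij⟩, fun y => ?_, hrange⟩
  by_contra! hy
  have hy' : ∀ z ∈ M, y < z ∨ z < y := by
    rw [← hrange]
    rintro _ ⟨j, rfl⟩
    exact hy j
  have hyM : y ∈ M := by
    rw [hM.2 (hM.1.insert fun z hz _ => (hy' z hz).imp le_of_lt le_of_lt) (Set.subset_insert y M)]
    exact Set.mem_insert y M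
  exact (hy' y hyM).elim (lt_irrefl y) (lt_irrefl y)

theorem exists_isMaximal_mem_range [Finite X] (y : X) :
    ∃ (k : ℕ) (f : SimplexChain X k), f.IsMaximal ∧ y ∈ Set.range f.1 := by
  obtain ⟨M, hM, hyM⟩ := (IsChain.singleton (r := (· ≤ ·)) (a := y)).exists_maxChain
  obtain ⟨f, hf, hfM⟩ := hM.exists_isMaximal
  exact ⟨_, f, hf, hfM.symm ▸ hyM rfl⟩

section Interval

variable {T : Type} [PartialOrder T] {p q : T}

theorem SimplexChain.exists_lower_bound {k : ℕ} (f : SimplexChain (Set.Ioo p q) k) (i : Fin k) :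
    ∃ a : T, ∀ x, a < x ↔ p < x ∧ ∀ j < i, (f.1 j : T) < x := by
  cases k with
  | zero => exact i.elim0
  | succ k =>
    induction i using Fin.cases with
    | zero => exact ⟨p, fun x => by simp⟩
    | succ i =>
      refine ⟨f.1 i.castSucc, fun x => ⟨fun hx => ⟨(f.1 i.castSucc).2.1.trans hx,
        fun j hj => ?_⟩, fun hx => hx.2 _ (Fin.castSucc_lt_succ)⟩⟩
      exact lt_of_le_of_lt (f.2.monotone (Fin.le_castSucc_iff.2 hj)) hx

theorem SimplexChain.exists_upper_bound {k : ℕ} (f : SimplexChain (Set.Ioo p q) k) (i : Fin k) :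
    ∃ b : T, ∀ x, x < b ↔ x < q ∧ ∀ j > i, x < (f.1 j : T) := by
  cases k with
  | zero => exact i.elim0
  | succ k =>
    induction i using Fin.lastCases with
    | last => exact ⟨q, fun x => by simp [Fin.le_last]⟩
    | cast i =>
      refine ⟨f.1 i.succ, fun x => ⟨fun hx => ⟨hx.trans (f.1 i.succ).2.2,
        fun j hj => ?_⟩, fun hx => hx.2 _ (Fin.castSucc_lt_succ)⟩⟩
      exact lt_of_lt_of_le hx (f.2.monotone (Fin.castSucc_lt_iff_succ_le.1 hj))

/-- If all maximal chains of every proper subinterval have the same size, every codimension-one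
face lies in an even number of maximal chains of its size plus one. -/
theorem even_card_isMaximal_face_eq [Finite T]
    (hT : ∀ a b : T, a < b → HasSphereHomology (Set.Ioo a b))
    (ih : ∀ a b : T, Set.Ioo a b ⊂ Set.Ioo p q → ∀ {k l : ℕ} {f : SimplexChain (Set.Ioo a b) k}
      {g : SimplexChain (Set.Ioo a b) l}, f.IsMaximal → g.IsMaximal → k = l)
    {k : ℕ} (i : Fin (k + 2)) (t : SimplexChain (Set.Ioo p q) (k + 1)) :
    Even (Nat.card {f : SimplexChain (Set.Ioo p q) (k + 2) // f.IsMaximal ∧ face i f = t}) := by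
  classical
  rcases isEmpty_or_nonempty
    {f : SimplexChain (Set.Ioo p q) (k + 2) // f.IsMaximal ∧ face i f = t}
    with hE | ⟨⟨s, hs, rfl⟩⟩
  · simp
  obtain ⟨a, ha⟩ := s.exists_lower_bound i
  obtain ⟨b, hb⟩ := s.exists_upper_bound i
  have hmem : ∀ x : T, x ∈ Set.Ioo a b ↔
      x ∈ Set.Ioo p q ∧ (∀ j < i, (s.1 j : T) < x) ∧ ∀ j > i, x < (s.1 j : T) := by
    intro x
    rw [Set.mem_Ioo, ha, hb, Set.mem_Ioo]
    tauto
  have hsub : Set.Ioo a b ⊂ Set.Ioo p q := by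
    refine ⟨fun x hx => ((hmem x).1 hx).1, fun hle => ?_⟩
    obtain ⟨j, hj⟩ := exists_ne i
    have h := (hmem _).1 (hle (s.1 j).2)
    rcases lt_or_gt_of_ne hj with hj | hj
    · exact lt_irrefl _ (h.2.1 j hj)
    · exact lt_irrefl _ (h.2.2 j hj)
  have hsi : (s.1 i : T) ∈ Set.Ioo a b :=
    (hmem _).2 ⟨(s.1 i).2, fun j hj => s.2 hj, fun j hj => s.2 hj⟩
  have hsing : (single (⟨s.1 i, hsi⟩ : Set.Ioo a b)).IsMaximal := by
    intro y
    refine ⟨0, fun hy => ?_⟩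
    have hy' := (hmem y).1 y.2
    obtain ⟨j, hj⟩ := hs ⟨y, hy'.1⟩
    apply hj
    rcases lt_trichotomy j i with h | rfl | h
    · exact Or.inr (hy'.2.1 j h)
    · exact hy
    · exact Or.inl (hy'.2.2 j h)
  have hall : ∀ x : Set.Ioo a b, (single x).IsMaximal := by
    intro x
    obtain ⟨m, g, hg, j, rfl⟩ := exists_isMaximal_mem_range x
    obtain rfl := ih a b hsub hg hsing
    intro y
    obtain ⟨l, hl⟩ := hg y
    rw [Subsingleton.elim l j] at hl
    exact ⟨0, hl⟩
  have : Nonempty (Set.Ioo a b) := ⟨⟨_, hsi⟩⟩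
  have htwo := (hT a b (hsi.1.trans hsi.2)).card_eq_two hall
  let φ : Set.Ioo a b →
      {f : SimplexChain (Set.Ioo p q) (k + 2) // f.IsMaximal ∧ face i f = face i s} := fun x => by
      have hx := (hmem x).1 x.2
      refine ⟨⟨Function.update s.1 i ⟨x, hx.1⟩, ?_⟩, ?_, ?_⟩
      · intro j l hjl
        rcases eq_or_ne j i with rfl | hj
        · rw [Function.update_self, Function.update_of_ne hjl.ne']
          exact hx.2.2 l hjl
        · rcases eq_or_ne l i with rfl | hl
          · rw [Function.update_self, Function.update_of_ne hj]
            exact hx.2.1 j hjl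
          · rw [Function.update_of_ne hj, Function.update_of_ne hl]
            exact s.2 hjl
      · intro y
        by_contra! hy
        have hyi : y < ⟨x, hx.1⟩ ∨ ⟨x, hx.1⟩ < y := by simpa using hy i
        have hyj : ∀ j ≠ i, y < s.1 j ∨ s.1 j < y := fun j hj => by
          simpa [Function.update_of_ne hj] using hy j
        have hns : ¬(y < s.1 i ∨ s.1 i < y) := fun h => by
          obtain ⟨j, hj⟩ := hs y
          rcases eq_or_ne j i with rfl | hji
          · exact hj h
          · exact hj (hyj j hji)
        have hyab : (y : T) ∈ Set.Ioo a b := by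
          refine (hmem y).2 ⟨y.2, fun j hj => ?_, fun j hj => ?_⟩
          · exact (hyj j hj.ne).resolve_left fun h => hns (Or.inl (h.trans (s.2 hj)))
          · exact (hyj j hj.ne').resolve_right fun h => hns (Or.inr ((s.2 hj).trans h))
        obtain ⟨_, h⟩ := hall x ⟨y, hyab⟩
        exact h hyi
      · ext j
        exact congrArg Subtype.val (Function.update_of_ne (Fin.succAbove_ne i j) _ _)
  have hφ : Function.Bijective φ := by
    constructor
    · intro x y hxy
      have h := congrFun (congrArg Subtype.val (congrArg Subtype.val hxy)) i
      simp only [φ, Function.update_self, Subtype.mk.injEq] at h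
      exact Subtype.ext h
    · rintro ⟨g, hg, hgs⟩
      have hgj : ∀ j ≠ i, g.1 j = s.1 j := by
        intro j hj
        obtain ⟨l, rfl⟩ := Fin.exists_succAbove_eq hj
        exact congrFun (congrArg Subtype.val hgs) l
      have hgi : (g.1 i : T) ∈ Set.Ioo a b := by
        refine (hmem _).2 ⟨(g.1 i).2, fun j hj => ?_, fun j hj => ?_⟩
        · rw [← hgj j hj.ne]
          exact g.2 hj
        · rw [← hgj j hj.ne']
          exact g.2 hj
      refine ⟨⟨_, hgi⟩, Subtype.ext (Subtype.ext ?_)⟩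
      change Function.update s.1 i (g.1 i) = g.1
      exact (Function.eq_update_iff.2 ⟨rfl, hgj⟩).symm
  rw [← Nat.card_congr (Equiv.ofBijective φ hφ), htwo]
  exact even_two

theorem SimplexChain.IsMaximal.size_unique [Finite T]
    (hT : ∀ a b : T, a < b → HasSphereHomology (Set.Ioo a b)) {p q : T} {k l : ℕ}
    {f : SimplexChain (Set.Ioo p q) k} {g : SimplexChain (Set.Ioo p q) l}
    (hf : f.IsMaximal) (hg : g.IsMaximal) : k = l := by
  induction hI : Set.Ioo p q using WellFoundedLT.induction generalizing p q k l with
  | _ I ih =>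
    subst hI
    match k, l, f, g, hf, hg with
    | 0, 0, _, _, _, _ => rfl
    | 0, l + 1, f, g, hf, _ => exact (hf (g.1 0)).choose.elim0
    | k + 1, 0, f, g, _, hg => exact (hg (f.1 0)).choose.elim0
    | k + 1, l + 1, f, g, hf, hg =>
      have hpq : HasSphereHomology (Set.Ioo p q) := hT p q ((f.1 0).2.1.trans (f.1 0).2.2)
      rcases subsingleton_or_nontrivial (Set.Ioo p q) with hs | hs
      · have h1 := f.2.injective.subsingleton
        have h2 := g.2.injective.subsingleton
        rw [Fin.subsingleton_iff_le_one] at h1 h2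
        omega
      · have key : ∀ {m : ℕ} {s : SimplexChain (Set.Ioo p q) (m + 1)}, s.IsMaximal →
            ∃ x ∈ cycles (Set.Ioo p q) (m + 1), x ∉ boundaries (Set.Ioo p q) (m + 1) := by
          intro m s hs'
          cases m with
          | zero =>
            obtain ⟨y, hy⟩ := exists_ne (s.1 0)
            have hs0 : s = single (s.1 0) := SimplexChain.ext fun j => by
              rw [Fin.fin_one_eq_zero j]
              rfl
            exact exists_cycle_of_single_isMaximal (hs0 ▸ hs') hy.symm
          | succ m =>
            exact exists_cycle_of_even hpq (even_card_isMaximal_face_eq hT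
              fun a b hab {_ _ _ _} hf hg => ih _ hab hf hg rfl) hs'
        obtain ⟨x, hx, hx'⟩ := key hf
        obtain ⟨y, hy, hy'⟩ := key hg
        exact hpq.degree_unique hx hx' hy hy'

/-- A maximal chain below `a` extends by `a` to a maximal chain below any cover of `a`. -/
theorem SimplexChain.IsMaximal.exists_of_covBy {a b : T} (hpa : p < a) (hab : a ⋖ b) {k : ℕ}
    {f : SimplexChain (Set.Ioo p a) k} (hf : f.IsMaximal) :
    ∃ g : SimplexChain (Set.Ioo p b) (k + 1), g.IsMaximal := by
  let g : Fin (k + 1) → Set.Ioo p b :=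
    Fin.snoc (α := fun _ => Set.Ioo p b)
      (fun j => ⟨f.1 j, (f.1 j).2.1, (f.1 j).2.2.trans hab.lt⟩) ⟨a, hpa, hab.lt⟩
  have hgc : ∀ j : Fin k, (g j.castSucc : T) = f.1 j := fun j => by simp [g]
  have hgl : (g (Fin.last k) : T) = a := by simp [g]
  refine ⟨⟨g, fun i j hij => ?_⟩, fun y => ?_⟩
  · change (g i : T) < g j
    induction i using Fin.lastCases with
    | last => exact absurd hij (Fin.le_last j).not_gt
    | cast i =>
      induction j using Fin.lastCases with
      | last =>
        rw [hgc, hgl]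
        exact (f.1 i).2.2
      | cast j =>
        rw [hgc, hgc]
        exact f.2 hij
  · by_contra! hy
    have hya : (y : T) < a ∨ a < y := hgl ▸ hy (Fin.last k)
    have hya := hya.resolve_right fun h => hab.2 h y.2.2
    obtain ⟨j, hj⟩ := hf ⟨y, y.2.1, hya⟩
    have hyj : (y : T) < f.1 j ∨ (f.1 j : T) < y := hgc j ▸ hy j.castSucc
    exact hj hyj

end Interval

/-- A poset is the open interval between the added least and greatest elements. -/
def orderIsoIooBotTop (P : Type) [PartialOrder P] :
    P ≃o Set.Ioo (⊥ : WithBot (WithTop P)) ⊤ where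
  toFun x := ⟨((x : WithTop P) : WithBot (WithTop P)), WithBot.bot_lt_coe _,
    WithBot.coe_lt_coe.2 (WithTop.coe_lt_top x)⟩
  invFun x := (x.1.unbot x.2.1.ne').untop fun h => x.2.2.ne (by
    rw [← WithBot.coe_unbot x.1 x.2.1.ne', h]
    rfl)
  left_inv x := rfl
  right_inv x := by
    ext
    simp
  map_rel_iff' {_ _} := WithBot.coe_le_coe.trans WithTop.coe_le_coe

/-- Every maximal chain of a Gorenstein* finite poset `P` has the same
length (equivalently, cardinality); equivalently, `P_{⊥,⊤}` admits a rank function,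
i.e. a function `rk : P_{⊥,⊤} → ℤ` with `rk q = rk p + 1` whenever `q` is an immediate
successor (cover) of `p`. -/
theorem statement16 (P : Type) [PartialOrder P] [Fintype P]
    (hP : IsGorensteinStar P) :
    (∀ c₁ c₂ : Set P, IsMaxChain (· ≤ ·) c₁ → IsMaxChain (· ≤ ·) c₂ →
      c₁.ncard = c₂.ncard) ∧
    (∃ rk : WithBot (WithTop P) → ℤ,
      ∀ a b : WithBot (WithTop P), a ⋖ b → rk b = rk a + 1) := by
  classical
  refine ⟨fun c₁ c₂ h₁ h₂ => ?_, ?_⟩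
  · have key : ∀ c : Set P, IsMaxChain (· ≤ ·) c →
        ∃ f : SimplexChain (Set.Ioo (⊥ : WithBot (WithTop P)) ⊤) c.ncard, f.IsMaximal := by
      intro c hc
      obtain ⟨f, hf, -⟩ := (hc.image (orderIsoIooBotTop P)).exists_isMaximal
      exact Set.ncard_image_of_injective c (orderIsoIooBotTop P).injective ▸ ⟨f, hf⟩
    obtain ⟨f, hf⟩ := key c₁ h₁
    obtain ⟨g, hg⟩ := key c₂ h₂
    exact hf.size_unique hP hg
  · have key : ∀ a : WithBot (WithTop P),
        ∃ (k : ℕ) (f : SimplexChain (Set.Ioo ⊥ a) k), f.IsMaximal := by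
      intro a
      obtain ⟨M, hM, -⟩ := (IsChain.empty (r := (· ≤ ·)) (α := Set.Ioo ⊥ a)).exists_maxChain
      obtain ⟨f, hf, -⟩ := hM.exists_isMaximal
      exact ⟨_, f, hf⟩
    choose n f hf using key
    refine ⟨fun a => if a = ⊥ then -1 else n a, fun a b hab => ?_⟩
    beta_reduce
    rw [if_neg (bot_le.trans_lt hab.lt).ne']
    split_ifs with ha
    · subst ha
      have : n b = 0 := by
        by_contra h0
        have hx := (f b).1 ⟨0, Nat.pos_of_ne_zero h0⟩
        exact hab.2 hx.2.1 hx.2.2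
      simp [this]
    · obtain ⟨g, hg⟩ := (hf a).exists_of_covBy (bot_lt_iff_ne_bot.2 ha) hab
      rw [(hf b).size_unique hP hg]
      push_cast
      rfl
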